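/- arXiv:0908.1218 — 2 statements merged into one kernel-verified Lean document; each statement's English description precedes it below -/
import Mathlib

section
/- Let C be an n×n integer matrix with C_{ij} ≥ 0 for all i,j and C_{ii} > 0 for all i, and let k be a field. Then there exists a finite dimensional k-algebra A together with a complete set of primitive orthogonal idempotents e_1,…,e_n such that dim_k(e_{n+1−j} A e_{n+1−i}) = C_{ij} for all 1 ≤ i,j ≤ n. -/
open Module

/-- The corner space `e·A·f` of an algebra `A`, as a `k`-submodule. -/
def corner (k : Type*) {A : Type*} [Field k] [Ring A] [Algebra k A] (e f : A) :
    Submodule k A :=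
  LinearMap.range ((LinearMap.mulLeft k e) ∘ₗ (LinearMap.mulRight k f))

/-- An idempotent `e` is primitive if it is nonzero and cannot be written as a sum of
two nonzero orthogonal idempotents. -/
def IsPrimitiveIdempotent {A : Type*} [Ring A] (e : A) : Prop :=
  IsIdempotentElem e ∧ e ≠ 0 ∧
    ∀ f g : A, IsIdempotentElem f → IsIdempotentElem g → f * g = 0 → g * f = 0 →
      e = f + g → f = 0 ∨ g = 0

/-- Path algebra modulo paths of length two: functions on vertices plus arrows. -/
def QAlg (k : Type u) (n : ℕ) (S : Type) (_ _ : S → Fin n) : Type u := (Fin n ⊕ S) → k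

namespace QAlg

variable {k : Type u} [Field k] {n : ℕ} {S : Type} {s t : S → Fin n}

instance : AddCommGroup (QAlg k n S s t) := inferInstanceAs (AddCommGroup ((Fin n ⊕ S) → k))
instance : Module k (QAlg k n S s t) := inferInstanceAs (Module k ((Fin n ⊕ S) → k))
instance [Finite S] : FiniteDimensional k (QAlg k n S s t) :=
  inferInstanceAs (FiniteDimensional k ((Fin n ⊕ S) → k))

/-- the product -/
def mulFn (f g : QAlg k n S s t) : QAlg k n S s t :=
  Sum.elim (fun i => f (.inl i) * g (.inl i))
    (fun a => f (.inl (s a)) * g (.inr a) + f (.inr a) * g (.inl (t a)))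

instance : Mul (QAlg k n S s t) := ⟨mulFn⟩
instance : One (QAlg k n S s t) := ⟨(Sum.elim (fun _ => 1) (fun _ => 0) : (Fin n ⊕ S) → k)⟩

theorem ext' {f g : QAlg k n S s t} (h1 : ∀ i, f (.inl i) = g (.inl i))
    (h2 : ∀ a, f (.inr a) = g (.inr a)) : f = g := by
  funext x
  cases x with
  | inl i => exact h1 i
  | inr a => exact h2 a

theorem mul_inl (f g : QAlg k n S s t) (i : Fin n) :
    (f * g) (.inl i) = f (.inl i) * g (.inl i) := rfl
theorem mul_inr (f g : QAlg k n S s t) (a : S) :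
    (f * g) (.inr a) = f (.inl (s a)) * g (.inr a) + f (.inr a) * g (.inl (t a)) := rfl
theorem one_inl (i : Fin n) : (1 : QAlg k n S s t) (.inl i) = 1 := rfl
theorem one_inr (a : S) : (1 : QAlg k n S s t) (.inr a) = 0 := rfl
theorem add_ap (f g : QAlg k n S s t) (x) : (f + g) x = f x + g x := rfl
theorem zero_ap (x) : (0 : QAlg k n S s t) x = 0 := rfl
theorem smul_ap (c : k) (f : QAlg k n S s t) (x) : (c • f) x = c * f x := rfl

instance : Ring (QAlg k n S s t) :=
  { (inferInstance : AddCommGroup (QAlg k n S s t)),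
    (inferInstance : Mul (QAlg k n S s t)),
    (inferInstance : One (QAlg k n S s t)) with
    left_distrib := fun a b c => by
      apply ext' <;> intro i <;> simp only [mul_inl, mul_inr, add_ap] <;> ring
    right_distrib := fun a b c => by
      apply ext' <;> intro i <;> simp only [mul_inl, mul_inr, add_ap] <;> ring
    zero_mul := fun a => by
      apply ext' <;> intro i <;> simp only [mul_inl, mul_inr, zero_ap] <;> ring
    mul_zero := fun a => by
      apply ext' <;> intro i <;> simp only [mul_inl, mul_inr, zero_ap] <;> ring
    mul_assoc := fun a b c => by
      apply ext' <;> intro i <;> simp only [mul_inl, mul_inr] <;> ring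
    one_mul := fun a => by
      apply ext' <;> intro i <;> simp only [mul_inl, mul_inr, one_inl, one_inr] <;> ring
    mul_one := fun a => by
      apply ext' <;> intro i <;> simp only [mul_inl, mul_inr, one_inl, one_inr] <;> ring }

instance : Algebra k (QAlg k n S s t) :=
  Algebra.ofModule
    (fun c f g => by
      apply ext' <;> intro i <;> simp only [mul_inl, mul_inr, smul_ap] <;> ring)
    (fun c f g => by
      apply ext' <;> intro i <;> simp only [mul_inl, mul_inr, smul_ap] <;> ring)

/-- vertex idempotents -/
def idem (p : Fin n) : QAlg k n S s t :=
  (Sum.elim (fun i => if i = p then 1 else 0) (fun _ => 0) : (Fin n ⊕ S) → k)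

theorem idem_inl (p i : Fin n) :
    (idem p : QAlg k n S s t) (.inl i) = if i = p then 1 else 0 := rfl
theorem idem_inr (p : Fin n) (a : S) : (idem p : QAlg k n S s t) (.inr a) = 0 := rfl

theorem idem_mul_self (p : Fin n) : (idem p : QAlg k n S s t) * idem p = idem p := by
  apply ext' <;> intro i <;> simp [mul_inl, mul_inr, idem_inl, idem_inr]

theorem idem_mul (p q : Fin n) (h : p ≠ q) : (idem p : QAlg k n S s t) * idem q = 0 := by
  apply ext' <;> intro i <;> simp [mul_inl, mul_inr, idem_inl, idem_inr, zero_ap]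
  rintro rfl; exact fun h' => h h'.symm

theorem sum_ap {ι : Type} (F : Finset ι) (f : ι → QAlg k n S s t) (x) :
    (∑ i ∈ F, f i) x = ∑ i ∈ F, f i x :=
  Finset.sum_apply (M := fun _ : Fin n ⊕ S => k) x F f

theorem sum_idem : ∑ i, (idem i : QAlg k n S s t) = 1 := by
  apply ext' <;> intro i <;> rw [sum_ap] <;> simp [idem_inl, idem_inr, one_inl, one_inr]

theorem eq_zero_of_idem (f : QAlg k n S s t) (hf : IsIdempotentElem f)
    (h : ∀ i, f (.inl i) = 0) : f = 0 := by
  apply ext' h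
  intro a
  have := congrFun hf (.inr a)
  rw [mul_inr, h, h] at this
  rw [← this, zero_ap]; ring

theorem idem_prim (p : Fin n) : IsPrimitiveIdempotent (idem p : QAlg k n S s t) := by
  refine ⟨idem_mul_self p, ?_, ?_⟩
  · intro h
    have := congrFun h (.inl p)
    rw [idem_inl, zero_ap] at this
    simp at this
  · intro f g hf hg hfg _ he
    have hm : ∀ i, f (.inl i) * g (.inl i) = 0 := fun i => congrFun hfg (.inl i)
    have hs : ∀ i, i ≠ p → f (.inl i) = 0 ∧ g (.inl i) = 0 := by
      intro i hi
      have h1 := congrFun he (.inl i)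
      rw [idem_inl, if_neg hi, add_ap] at h1
      have h2 := hm i
      rcases mul_eq_zero.mp h2 with h | h
      · rw [h, zero_add] at h1
        exact ⟨h, h1.symm⟩
      · rw [h, add_zero] at h1
        exact ⟨h1.symm, h⟩
    rcases mul_eq_zero.mp (hm p) with h | h
    · left
      apply eq_zero_of_idem f hf
      intro i
      by_cases hi : i = p
      · rw [hi, h]
      · exact (hs i hi).1
    · right
      apply eq_zero_of_idem g hg
      intro i
      by_cases hi : i = p
      · rw [hi, h]
      · exact (hs i hi).2

theorem finrank_corner [Fintype S] (p q : Fin n) :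
    finrank k (corner k (idem p : QAlg k n S s t) (idem q)) =
      (if p = q then 1 else 0) + ∑ a : S, if s a = p ∧ t a = q then 1 else 0 := by
  classical
  let w : Fin n ⊕ S → k := Sum.elim (fun i => if i = p ∧ i = q then 1 else 0)
    (fun a => if s a = p ∧ t a = q then 1 else 0)
  have h1 : ((LinearMap.mulLeft k (idem p : QAlg k n S s t)) ∘ₗ
      (LinearMap.mulRight k (idem q)) : QAlg k n S s t →ₗ[k] QAlg k n S s t) =
      (Matrix.mulVecLin (Matrix.diagonal w) : (Fin n ⊕ S → k) →ₗ[k] (Fin n ⊕ S → k)) := by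
    apply LinearMap.ext
    intro f
    have h2 : ∀ x, (Matrix.mulVecLin (Matrix.diagonal w) : (Fin n ⊕ S → k) →ₗ[k] _) f x
        = w x * f x := fun x => Matrix.mulVec_diagonal w f x
    apply ext'
    · intro i
      refine Eq.trans ?_ (h2 _).symm
      rw [LinearMap.comp_apply, LinearMap.mulRight_apply, LinearMap.mulLeft_apply]
      simp only [mul_inl, idem_inl, w, Sum.elim_inl]
      clear h2
      by_cases h : i = p <;> by_cases h' : i = q <;> simp only [h, h', and_self, and_true,
        true_and, if_true, if_false, and_false, false_and] <;> grind
    · intro i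
      refine Eq.trans ?_ (h2 _).symm
      rw [LinearMap.comp_apply, LinearMap.mulRight_apply, LinearMap.mulLeft_apply]
      simp only [mul_inl, mul_inr, idem_inl, idem_inr, w, Sum.elim_inr]
      split_ifs <;> simp_all
  have h3 : finrank k (corner k (idem p : QAlg k n S s t) (idem q)) =
      (Matrix.diagonal w).rank := by
    unfold corner
    rw [h1]
    rfl
  rw [h3, Matrix.rank_diagonal, Fintype.card_subtype, Finset.card_filter, Fintype.sum_sum_type]
  congr 1
  · by_cases h : p = q
    · subst h; simp [w]
    · have : ∀ i, ¬ (i = p ∧ i = q) := fun i hi => h (hi.1.symm.trans hi.2)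
      simp [w, h, this]
  · simp [w]

end QAlg

/-- Any integer matrix `C` with nonnegative entries and positive diagonal entries is the
Cartan matrix of a finite dimensional algebra: there exist a finite dimensional `k`-algebra
`A` and a complete set of primitive orthogonal idempotents `e_1, …, e_n` with
`dim_k (e_{n+1−j} A e_{n+1−i}) = C_{ij}` for all `i, j`. -/
theorem exists_algebra_with_cartan_matrix {n : ℕ} (C : Matrix (Fin n) (Fin n) ℤ)
    (hpos : ∀ i j, 0 ≤ C i j) (hdiag : ∀ i, 0 < C i i)
    (k : Type u) [Field k] :
    ∃ (A : Type u) (_ : Ring A) (_ : Algebra k A) (_ : FiniteDimensional k A)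
      (e : Fin n → A),
      (∀ i, IsPrimitiveIdempotent (e i)) ∧
      (∀ i j, i ≠ j → e i * e j = 0) ∧
      (∑ i, e i) = 1 ∧
      (∀ i j, (finrank k (corner k (e j.rev) (e i.rev)) : ℤ) = C i j) := by
  classical
  let S : Type := Σ x : Fin n × Fin n,
    Fin (C x.2.rev x.1.rev - if x.1 = x.2 then 1 else 0).toNat
  refine ⟨QAlg k n S (fun a => a.1.1) (fun a => a.1.2), inferInstance, inferInstance,
    inferInstance, QAlg.idem, QAlg.idem_prim, QAlg.idem_mul, QAlg.sum_idem, ?_⟩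
  intro i j
  rw [QAlg.finrank_corner, Fintype.sum_sigma, Fintype.sum_eq_single (j.rev, i.rev)]
  · have h1 := hpos i j
    by_cases h : j = i
    · subst h
      have := hdiag j
      simp
      omega
    · simp [h, h1]
  · rintro ⟨x, y⟩ hx
    have : ¬ (x = j.rev ∧ y = i.rev) := by
      rintro ⟨rfl, rfl⟩; exact hx rfl
    simp [this]
end

section
/- Let B be an n×n matrix over a commutative ring such that B is upper triangular, i.e., B_{ij} = 0 for i > j, and B_{ii} = 1 for all i. Then in the decomposition B = B₊ + B₋ᵀ of the paper one has B₊ = B and B₋ = 0, and consequently r^B_1 ⋯ r^B_n = −B⁻¹·0 = 0, i.e., the product of the matrices r^B_i (identity minus the i-th row of B) is the zero matrix. -/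
open Matrix

/-- The matrix `r^B_i`: the identity with the `i`-th row of `B` subtracted. -/
def reflMat {n : ℕ} {R : Type*} [CommRing R] (B : Matrix (Fin n) (Fin n) R) (i : Fin n) :
    Matrix (Fin n) (Fin n) R :=
  Matrix.of fun s t => (if s = t then (1 : R) else 0) - (if s = i then B i t else 0)

/-- The upper triangular part `B₊` of `B`, with ones on the diagonal. -/
def upperPart {n : ℕ} {R : Type*} [CommRing R] (B : Matrix (Fin n) (Fin n) R) :
    Matrix (Fin n) (Fin n) R :=
  Matrix.of fun i j => if i < j then B i j else if i = j then 1 else 0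

/-- The lower triangular part `B₋` of `B`. -/
def lowerPart {n : ℕ} {R : Type*} [CommRing R] (B : Matrix (Fin n) (Fin n) R) :
    Matrix (Fin n) (Fin n) R :=
  Matrix.of fun i j => if i < j then B j i else if i = j then B i i - 1 else 0

/-- If `B` is upper triangular with ones on the diagonal, then `B₊ = B`, `B₋ = 0` and
the product `r^B_1 ⋯ r^B_n` is the zero matrix. -/
theorem prod_reflMat_eq_zero_of_unitriangular
    {n : ℕ} {R : Type*} [CommRing R] (B : Matrix (Fin n) (Fin n) R)
    (hdiag : ∀ i, B i i = 1) (hlower : ∀ i j : Fin n, j < i → B i j = 0) :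
    upperPart B = B ∧ lowerPart B = 0 ∧
      (List.ofFn fun i : Fin n => reflMat B i).prod = 0 := by
  refine ⟨?_, ?_, ?_⟩
  · ext i j
    simp only [upperPart, Matrix.of_apply]
    split_ifs with h h'
    · rfl
    · subst h'; exact (hdiag i).symm
    · exact (hlower i j (lt_of_le_of_ne (not_lt.mp h) (Ne.symm h'))).symm
  · ext i j
    simp only [lowerPart, Matrix.of_apply, Matrix.zero_apply]
    split_ifs with h h'
    · exact hlower j i h
    · rw [hdiag, sub_self]
    · rfl
  · have key : ∀ k : ℕ, k ≤ n → ∀ s t : Fin n, (t : ℕ) < k →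
        ((List.ofFn fun i : Fin n => reflMat B i).take k).prod s t = 0 := by
      intro k
      induction k with
      | zero => intro _ s t h; exact absurd h (Nat.not_lt_zero _)
      | succ k ih =>
        intro hk s t ht
        rw [List.prod_take_succ _ k (by simpa using hk), List.getElem_ofFn]
        generalize hP : ((List.ofFn fun i : Fin n => reflMat B i).take k).prod = P
        have hmul : (P * reflMat B ⟨k, hk⟩) s t = P s t - P s ⟨k, hk⟩ * B ⟨k, hk⟩ t := by
          simp [Matrix.mul_apply, reflMat, mul_sub, Finset.sum_sub_distrib]
        rw [hmul]
        rcases Nat.lt_succ_iff_lt_or_eq.mp ht with h | h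
        · have h1 := ih (by omega) s t h
          rw [hP] at h1
          rw [h1, hlower ⟨k, hk⟩ t h, mul_zero, sub_zero]
        · have : t = ⟨k, hk⟩ := Fin.ext h
          rw [this, hdiag, mul_one, sub_self]
    ext s t
    have h := key n le_rfl s t t.isLt
    rwa [List.take_of_length_le (by simp)] at h
end
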